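/- arXiv:2506.21493 — 3 statements merged into one kernel-verified Lean document; each statement's English description precedes it below -/
import Mathlib

section
/- Define the sequence n_1 = 2 and n_{d+1} = n_d·(n_d + 1) for d ≥ 1. Suppose that for every integer d ≥ 1, every finite item set M, every number of agents n with n < n_d, and every profile of normalized, monotone, subadditive valuations on M, there exists a d-multi-allocation giving each agent i a bundle of value at least (1/2)·MMS(M, v_i, n). Then for every finite item set M, every n ≥ 4, and every profile of n normalized, monotone, subadditive valuations on M, there exists an allocation (A_1, …, A_n) with v_i(A_i) ≥ MMS(M, v_i, n) / (8·(⌈log₂ log₂ n⌉ + 1)) for every agent i. -/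
open Finset

universe u

/-- A valuation on `M`: normalized, monotone, and subadditive. -/
def IsValuation {α : Type*} [DecidableEq α] (M : Finset α) (v : Finset α → ℝ) : Prop :=
  v ∅ = 0 ∧ (∀ S T : Finset α, S ⊆ T → T ⊆ M → v S ≤ v T) ∧
    ∀ S T : Finset α, S ⊆ M → T ⊆ M → v (S ∪ T) ≤ v S + v T

/-- `MMS(M, v, k)`: the maximum, over all partitions of `M` into `k` bundles, of the
minimum value of a bundle. -/
noncomputable def MMS {α : Type*} [DecidableEq α] (M : Finset α) (v : Finset α → ℝ)
    (k : ℕ) : ℝ :=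
  sSup {x : ℝ | ∃ P : Fin k → Finset α,
    (∀ i j, i ≠ j → Disjoint (P i) (P j)) ∧
    Finset.univ.biUnion P = M ∧ x = ⨅ i : Fin k, v (P i)}

/-- The sequence `n_1 = 2`, `n_{d+1} = n_d (n_d + 1)`. (`nSeq 0` is junk.) -/
def nSeq : ℕ → ℕ
  | 0 => 1
  | 1 => 2
  | d + 2 => nSeq (d + 1) * (nSeq (d + 1) + 1)

/-- The expectation of `f` on a random subset of `A` that contains each item independently with
probability `ρ`. -/
noncomputable def sampleMean {α : Type*} [DecidableEq α] (ρ : ℝ) (A : Finset α)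
    (f : Finset α → ℝ) : ℝ :=
  ∑ T ∈ A.powerset, ρ ^ T.card * (1 - ρ) ^ (A.card - T.card) * f T

section SampleMean

variable {α : Type*} [DecidableEq α]

theorem sampleMean_empty (ρ : ℝ) (f : Finset α → ℝ) : sampleMean ρ ∅ f = f ∅ := by
  simp [sampleMean]

theorem sampleMean_insert (ρ : ℝ) {A : Finset α} {e : α} (he : e ∉ A) (f : Finset α → ℝ) :
    sampleMean ρ (insert e A) f =
      (1 - ρ) * sampleMean ρ A f + ρ * sampleMean ρ A (fun T => f (insert e T)) := by
  unfold sampleMean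
  rw [Finset.sum_powerset_insert he, Finset.mul_sum, Finset.mul_sum]
  congr 1
  · refine Finset.sum_congr rfl fun T hT => ?_
    have hc := Finset.card_le_card (Finset.mem_powerset.1 hT)
    rw [Finset.card_insert_of_notMem he, Nat.sub_add_comm hc, pow_succ]
    ring
  · refine Finset.sum_congr rfl fun T hT => ?_
    have heT : e ∉ T := fun h => he (Finset.mem_powerset.1 hT h)
    rw [Finset.card_insert_of_notMem he, Finset.card_insert_of_notMem heT,
      Nat.add_sub_add_right, pow_succ]
    ring

theorem sampleMean_mono {ρ : ℝ} (h0 : 0 ≤ ρ) (h1 : ρ ≤ 1) (A : Finset α)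
    {f g : Finset α → ℝ} (hfg : ∀ T, f T ≤ g T) : sampleMean ρ A f ≤ sampleMean ρ A g := by
  unfold sampleMean
  have h2 : 0 ≤ 1 - ρ := by linarith
  exact Finset.sum_le_sum fun T _ => mul_le_mul_of_nonneg_left (hfg T) (by positivity)

theorem sampleMean_nonneg {ρ : ℝ} (h0 : 0 ≤ ρ) (h1 : ρ ≤ 1) (A : Finset α)
    {f : Finset α → ℝ} (hf : ∀ T, 0 ≤ f T) : 0 ≤ sampleMean ρ A f := by
  unfold sampleMean
  have h2 : 0 ≤ 1 - ρ := by linarith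
  exact Finset.sum_nonneg fun T _ => mul_nonneg (by positivity) (hf T)

theorem sampleMean_mul_left (ρ c : ℝ) (A : Finset α) (f : Finset α → ℝ) :
    sampleMean ρ A (fun T => c * f T) = c * sampleMean ρ A f := by
  unfold sampleMean
  rw [Finset.mul_sum]
  exact Finset.sum_congr rfl fun T _ => by ring

/-- Colouring the items uniformly at random with `d` colours, the sets
`{e ∈ A t | φ e = idx t e}` are random subsets of `A t` of density `1 / d`; some colouring does
at least as well as the average. -/
theorem exists_coloring_sum_le {ι : Type*} [Fintype ι] {d : ℕ} (hd : 0 < d) (M : Finset α) :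
    ∀ (A : ι → Finset α), (∀ t, A t ⊆ M) → ∀ (idx : ι → α → Fin d) (f : ι → Finset α → ℝ),
      ∃ φ : α → Fin d, ∑ t, f t {e ∈ A t | φ e = idx t e} ≤
        ∑ t, sampleMean (1 / (d : ℝ)) (A t) (f t) := by
  induction M using Finset.induction_on with
  | empty =>
    intro A hA idx f
    refine ⟨fun _ => ⟨0, hd⟩, Finset.sum_le_sum fun t _ => ?_⟩
    simp [Finset.subset_empty.1 (hA t), sampleMean_empty]
  | insert e M he ih =>
    intro A hA idx f
    have hd' : (d : ℝ) ≠ 0 := by positivity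
    let g : Fin d → ι → Finset α → ℝ := fun c t T =>
      if e ∈ A t ∧ c = idx t e then f t (insert e T) else f t T
    have key : ∀ t, ∑ c, sampleMean (1 / (d : ℝ)) ((A t).erase e) (g c t) =
        d * sampleMean (1 / (d : ℝ)) (A t) (f t) := by
      intro t
      by_cases h : e ∈ A t
      · have h1 : ∀ c, sampleMean (1 / (d : ℝ)) ((A t).erase e) (g c t) =
            sampleMean (1 / (d : ℝ)) ((A t).erase e) (f t) +
            if c = idx t e then sampleMean (1 / (d : ℝ)) ((A t).erase e)
              (fun T => f t (insert e T)) - sampleMean (1 / (d : ℝ)) ((A t).erase e) (f t)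
            else 0 := by
          intro c
          by_cases hc : c = idx t e <;> simp [g, h, hc]
        have h2 := sampleMean_insert (1 / (d : ℝ)) (Finset.notMem_erase e (A t)) (f t)
        rw [Finset.insert_erase h] at h2
        rw [Finset.sum_congr rfl fun c _ => h1 c, Finset.sum_add_distrib, h2]
        simp
        field_simp
        ring
      · simp [g, h]
    obtain ⟨c, -, hc⟩ : ∃ c ∈ (Finset.univ : Finset (Fin d)),
        ∑ t, sampleMean (1 / (d : ℝ)) ((A t).erase e) (g c t) ≤
          ∑ t, sampleMean (1 / (d : ℝ)) (A t) (f t) := by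
      refine Finset.exists_le_of_sum_le ⟨⟨0, hd⟩, Finset.mem_univ _⟩ ?_
      rw [Finset.sum_comm, Finset.sum_congr rfl fun t _ => key t, ← Finset.mul_sum]
      simp
    obtain ⟨φ, hφ⟩ := ih (fun t => (A t).erase e)
      (fun t => by
        have := Finset.erase_subset_erase e (hA t)
        rwa [Finset.erase_insert he] at this) idx (g c)
    refine ⟨Function.update φ e c, le_trans (le_of_eq ?_) (hφ.trans hc)⟩
    refine Finset.sum_congr rfl fun t _ => ?_
    by_cases h : e ∈ A t ∧ c = idx t e
    · simp only [g, if_pos h]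
      congr 1
      ext x
      by_cases hx : x = e
      · subst hx; simp [h.1, ← h.2]
      · simp [hx]
    · simp only [g, if_neg h]
      congr 1
      ext x
      by_cases hx : x = e
      · subst hx; simpa using h
      · simp [hx]

theorem two_family_step {ρ p q s t : ℝ} (h0 : 0 ≤ ρ) (h1 : ρ ≤ 1) (hp : p ≤ 1)
    (hq0 : 0 ≤ q) (hq : q ≤ 2) (hs0 : 0 ≤ s) (ht0 : 0 ≤ t) (hs1 : s ≤ 1) (ht1 : t ≤ 1)
    (hqs : q * s ≤ 1) (hqt : q * t ≤ 1) :
    ((1 - ρ) * p + ρ * q) * ((1 - ρ) + ρ * s) * ((1 - ρ) + ρ * t) ≤ 1 := by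
  have h2 : 0 ≤ 1 - ρ := by linarith
  have ha : (1 - ρ) * p + ρ * q ≤ 1 - ρ + ρ * q := by nlinarith
  have hs' : 0 ≤ (1 - ρ) + ρ * s := by positivity
  have ht' : 0 ≤ (1 - ρ) + ρ * t := by positivity
  have hs1' : (1 - ρ) + ρ * s ≤ 1 := by nlinarith
  have ht1' : (1 - ρ) + ρ * t ≤ 1 := by nlinarith
  have hb : ((1 - ρ) * p + ρ * q) * ((1 - ρ) + ρ * s) * ((1 - ρ) + ρ * t) ≤
      (1 - ρ + ρ * q) * ((1 - ρ) + ρ * s) * ((1 - ρ) + ρ * t) := by gcongr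
  refine hb.trans ?_
  rcases le_total q 1 with h | h
  · have : 1 - ρ + ρ * q ≤ 1 := by nlinarith
    have h5 : 0 ≤ 1 - ρ + ρ * q := by positivity
    exact mul_le_one₀ (mul_le_one₀ this hs' hs1') ht' ht1'
  · have hsx : 1 - ρ + ρ * s ≤ 1 - ρ * ((q - 1) / 2) := by
      have : s ≤ 1 - (q - 1) / 2 := by nlinarith
      nlinarith
    have htx : 1 - ρ + ρ * t ≤ 1 - ρ * ((q - 1) / 2) := by
      have : t ≤ 1 - (q - 1) / 2 := by nlinarith
      nlinarith
    obtain ⟨x, hx⟩ : ∃ x, x = ρ * ((q - 1) / 2) := ⟨_, rfl⟩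
    have hx0 : 0 ≤ x := by rw [hx]; exact mul_nonneg h0 (by linarith)
    have hx1 : x ≤ 1 := by rw [hx]; nlinarith
    have hqx : 1 - ρ + ρ * q = 1 + 2 * x := by rw [hx]; ring
    rw [← hx] at hsx htx
    rw [hqx]
    calc (1 + 2 * x) * (1 - ρ + ρ * s) * (1 - ρ + ρ * t)
        ≤ (1 + 2 * x) * (1 - x) * (1 - x) := by gcongr
      _ ≤ 1 := by nlinarith [mul_nonneg hx0 hx0]

/-- Talagrand's inequality for control by two points, for down-closed families of subsets of a
finite set under a product measure. -/
theorem sampleMean_mul_mul_le_one {ρ : ℝ} (h0 : 0 ≤ ρ) (h1 : ρ ≤ 1) (A : Finset α) :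
    ∀ (F G : Set (Finset α)), IsLowerSet F → IsLowerSet G → ∀ h : Finset α → ℝ, (∀ x, 0 ≤ h x) →
      (∀ x, ∀ Y ∈ F, ∀ Z ∈ G, h x ≤ 2 ^ (x \ (Y ∪ Z)).card) →
      sampleMean ρ A h * sampleMean ρ A (F.indicator 1) * sampleMean ρ A (G.indicator 1) ≤ 1 := by
  have ind0 : ∀ (F : Set (Finset α)) x, (0 : ℝ) ≤ F.indicator 1 x := fun F x =>
    Set.indicator_nonneg (fun _ _ => zero_le_one) x
  induction A using Finset.induction_on with
  | empty =>
    intro F G _ _ h h0' hh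
    simp only [sampleMean_empty]
    by_cases hF : ∅ ∈ F <;> by_cases hG : ∅ ∈ G <;> simp [hF, hG]
    simpa using hh ∅ ∅ hF ∅ hG
  | insert e A he ih =>
    intro F G hF hG h hh0 hh
    have lower : ∀ F : Set (Finset α), IsLowerSet F → IsLowerSet {Y | insert e Y ∈ F} :=
      fun F hF S T hTS hS => hF (Finset.insert_subset_insert e hTS) hS
    have shrink : ∀ F : Set (Finset α), IsLowerSet F →
        sampleMean ρ A ({Y | insert e Y ∈ F}.indicator 1) ≤ sampleMean ρ A (F.indicator 1) := by
      intro F hF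
      refine sampleMean_mono h0 h1 A fun T => ?_
      refine Set.indicator_le_indicator_of_subset (fun Y hY => ?_) (fun _ => zero_le_one) T
      exact hF (Finset.subset_insert e Y) hY
    have ins : ∀ F : Set (Finset α),
        (fun T => F.indicator (1 : Finset α → ℝ) (insert e T)) =
          {Y | insert e Y ∈ F}.indicator 1 := by
      intro F; ext T; simp [Set.indicator]
    rw [sampleMean_insert ρ he, sampleMean_insert ρ he, sampleMean_insert ρ he, ins, ins]
    have i00 := ih F G hF hG h hh0 hh
    have i10 := ih {Y | insert e Y ∈ F} G (lower F hF) hG (fun T => h (insert e T))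
      (fun x => hh0 _) (by
        intro x Y hY Z hZ
        refine (hh (insert e x) _ hY Z hZ).trans ?_
        refine pow_le_pow_right₀ one_le_two (Finset.card_le_card fun y => ?_)
        simp only [Finset.mem_sdiff, Finset.mem_union, Finset.mem_insert]
        tauto)
    have i01 := ih F {Y | insert e Y ∈ G} hF (lower G hG) (fun T => h (insert e T))
      (fun x => hh0 _) (by
        intro x Y hY Z hZ
        refine (hh (insert e x) Y hY _ hZ).trans ?_
        refine pow_le_pow_right₀ one_le_two (Finset.card_le_card fun y => ?_)
        simp only [Finset.mem_sdiff, Finset.mem_union, Finset.mem_insert]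
        tauto)
    have i11 := ih F G hF hG (fun T => (1 / 2) * h (insert e T))
      (fun x => mul_nonneg (by norm_num) (hh0 _)) (by
        intro x Y hY Z hZ
        have h2 := hh (insert e x) Y hY Z hZ
        have h3 : (2 : ℝ) ^ (insert e x \ (Y ∪ Z)).card ≤ 2 ^ ((x \ (Y ∪ Z)).card + 1) := by
          refine pow_le_pow_right₀ one_le_two ?_
          refine (Finset.card_le_card ?_).trans (Finset.card_insert_le e _)
          intro y
          simp only [Finset.mem_sdiff, Finset.mem_insert]
          tauto
        rw [pow_succ] at h3
        linarith)
    rw [sampleMean_mul_left] at i11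
    have nE1 : 0 ≤ sampleMean ρ A (fun T => h (insert e T)) :=
      sampleMean_nonneg h0 h1 A fun T => hh0 _
    have na0 : 0 ≤ sampleMean ρ A (F.indicator 1) := sampleMean_nonneg h0 h1 A (ind0 F)
    have nb0 : 0 ≤ sampleMean ρ A (G.indicator 1) := sampleMean_nonneg h0 h1 A (ind0 G)
    have na1 : 0 ≤ sampleMean ρ A ({Y | insert e Y ∈ F}.indicator 1) :=
      sampleMean_nonneg h0 h1 A (ind0 _)
    have nb1 : 0 ≤ sampleMean ρ A ({Y | insert e Y ∈ G}.indicator 1) :=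
      sampleMean_nonneg h0 h1 A (ind0 _)
    have la := shrink F hF
    have lb := shrink G hG
    generalize sampleMean ρ A (F.indicator 1) = a0 at *
    generalize sampleMean ρ A (G.indicator 1) = b0 at *
    generalize sampleMean ρ A ({Y | insert e Y ∈ F}.indicator 1) = a1 at *
    generalize sampleMean ρ A ({Y | insert e Y ∈ G}.indicator 1) = b1 at *
    generalize sampleMean ρ A h = E0 at *
    generalize sampleMean ρ A (fun T => h (insert e T)) = E1 at *
    rcases na0.eq_or_lt with ha | ha
    · have : a1 = 0 := by linarith
      simp [← ha, this]
    rcases nb0.eq_or_lt with hb | hb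
    · have : b1 = 0 := by linarith
      simp [← hb, this]
    have hstep := two_family_step (p := E0 * a0 * b0) (q := E1 * a0 * b0) (s := a1 / a0)
      (t := b1 / b0) h0 h1 i00 (by positivity) (by linarith) (by positivity) (by positivity)
      ((div_le_one ha).2 la) ((div_le_one hb).2 lb)
      (by
        have : E1 * a0 * b0 * (a1 / a0) = E1 * a1 * b0 := by field_simp
        rwa [this])
      (by
        have : E1 * a0 * b0 * (b1 / b0) = E1 * a0 * b1 := by field_simp
        rwa [this])
    refine le_trans (le_of_eq ?_) hstep
    field_simp

end SampleMean

section Valuation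

variable {α : Type*} [DecidableEq α] {M : Finset α} {v : Finset α → ℝ}

theorem IsValuation.mono_set {M' : Finset α} (hv : IsValuation M v) (h : M' ⊆ M) :
    IsValuation M' v :=
  ⟨hv.1, fun S T hST hT => hv.2.1 S T hST (hT.trans h),
    fun S T hS hT => hv.2.2 S T (hS.trans h) (hT.trans h)⟩

theorem IsValuation.biUnion_le {κ : Type*} (hv : IsValuation M v) (s : Finset κ)
    (f : κ → Finset α) (hf : ∀ k ∈ s, f k ⊆ M) : v (s.biUnion f) ≤ ∑ k ∈ s, v (f k) := by
  classical
  induction s using Finset.induction_on with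
  | empty => simp [hv.1]
  | insert k s hk ih =>
    rw [Finset.biUnion_insert, Finset.sum_insert hk]
    have h1 : ∀ k ∈ s, f k ⊆ M := fun j hj => hf j (Finset.mem_insert_of_mem hj)
    have := hv.2.2 (f k) (s.biUnion f) (hf k (Finset.mem_insert_self k s))
      (Finset.biUnion_subset.2 h1)
    linarith [ih h1]

theorem exists_partition_MMS_le (M : Finset α) (v : Finset α → ℝ) {n : ℕ} (hn : 0 < n) :
    ∃ P : Fin n → Finset α, (∀ i j, i ≠ j → Disjoint (P i) (P j)) ∧ (∀ i, P i ⊆ M) ∧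
      ∀ i, MMS M v n ≤ v (P i) := by
  have hfin : {x : ℝ | ∃ P : Fin n → Finset α, (∀ i j, i ≠ j → Disjoint (P i) (P j)) ∧
      Finset.univ.biUnion P = M ∧ x = ⨅ i : Fin n, v (P i)}.Finite := by
    refine ((Fintype.piFinset fun _ : Fin n => M.powerset).finite_toSet.image
      fun P => ⨅ i, v (P i)).subset ?_
    rintro x ⟨P, -, hP, rfl⟩
    refine ⟨P, ?_, rfl⟩
    simp only [Finset.mem_coe, Fintype.mem_piFinset, Finset.mem_powerset]
    intro i
    rw [← hP]
    exact Finset.subset_biUnion_of_mem P (Finset.mem_univ i)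
  have hne : {x : ℝ | ∃ P : Fin n → Finset α, (∀ i j, i ≠ j → Disjoint (P i) (P j)) ∧
      Finset.univ.biUnion P = M ∧ x = ⨅ i : Fin n, v (P i)}.Nonempty := by
    refine ⟨_, fun i => if i = ⟨0, hn⟩ then M else ∅, ?_, ?_, rfl⟩
    · intro i j hij
      by_cases hi : i = ⟨0, hn⟩
      · have hj : j ≠ ⟨0, hn⟩ := fun h => hij (hi.trans h.symm)
        simp [hj]
      · simp [hi]
    · ext x
      simp only [Finset.mem_biUnion, Finset.mem_univ, true_and]
      constructor
      · rintro ⟨i, hi⟩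
        split_ifs at hi
        · exact hi
        · simp at hi
      · exact fun hx => ⟨⟨0, hn⟩, by simpa using hx⟩
  obtain ⟨P, hd, hP, hx⟩ := hne.csSup_mem hfin
  refine ⟨P, hd, fun i => ?_, fun i => ?_⟩
  · rw [← hP]
    exact Finset.subset_biUnion_of_mem P (Finset.mem_univ i)
  · unfold MMS
    rw [hx]
    exact ciInf_le (Set.finite_range _).bddBelow i

theorem le_MMS (hv : IsValuation M v) {n : ℕ} (hn : 0 < n) {x : ℝ} (Q : Fin n → Finset α)
    (hdisj : ∀ i j, i ≠ j → Disjoint (Q i) (Q j)) (hQ : ∀ i, Q i ⊆ M) (hx : ∀ i, x ≤ v (Q i)) :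
    x ≤ MMS M v n := by
  have : Nonempty (Fin n) := ⟨⟨0, hn⟩⟩
  let P : Fin n → Finset α := fun i =>
    if i = ⟨0, hn⟩ then Q i ∪ (M \ Finset.univ.biUnion Q) else Q i
  have hQP : ∀ i, Q i ⊆ P i := by
    intro i
    by_cases hi : i = ⟨0, hn⟩ <;> simp [P, hi]
  have hPM : ∀ i, P i ⊆ M := by
    intro i
    by_cases hi : i = ⟨0, hn⟩
    · simp only [P, if_pos hi]
      exact Finset.union_subset (hQ i) Finset.sdiff_subset
    · simp only [P, if_neg hi]
      exact hQ i
  have hrest : ∀ i, Disjoint (Q i) (M \ Finset.univ.biUnion Q) := fun i =>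
    Finset.disjoint_sdiff.mono_left (Finset.subset_biUnion_of_mem Q (Finset.mem_univ i))
  refine (le_ciInf fun i => (hx i).trans (hv.2.1 _ _ (hQP i) (hPM i))).trans
    (le_csSup ⟨v M, ?_⟩ ⟨P, ?_, ?_, rfl⟩)
  · rintro y ⟨P', -, hP', rfl⟩
    refine (ciInf_le (Set.finite_range _).bddBelow (⟨0, hn⟩ : Fin n)).trans
      (hv.2.1 _ _ ?_ subset_rfl)
    conv_rhs => rw [← hP']
    exact Finset.subset_biUnion_of_mem P' (Finset.mem_univ _)
  · intro i j hij
    by_cases hi : i = ⟨0, hn⟩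
    · have hj : j ≠ ⟨0, hn⟩ := fun h => hij (hi.trans h.symm)
      simp only [P, if_pos hi, if_neg hj]
      exact Finset.disjoint_union_left.2 ⟨hdisj i j hij, (hrest j).symm⟩
    · by_cases hj : j = ⟨0, hn⟩
      · simp only [P, if_neg hi, if_pos hj]
        exact Finset.disjoint_union_right.2 ⟨hdisj i j hij, hrest i⟩
      · simp only [P, if_neg hi, if_neg hj]
        exact hdisj i j hij
  · refine Finset.Subset.antisymm (Finset.biUnion_subset.2 fun i _ => hPM i) fun y hy => ?_
    by_cases hyQ : y ∈ Finset.univ.biUnion Q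
    · obtain ⟨i, -, hi⟩ := Finset.mem_biUnion.1 hyQ
      exact Finset.mem_biUnion.2 ⟨i, Finset.mem_univ i, hQP i hi⟩
    · refine Finset.mem_biUnion.2 ⟨⟨0, hn⟩, Finset.mem_univ _, ?_⟩
      simp only [P, if_true]
      exact Finset.mem_union_right _ (Finset.mem_sdiff.2 ⟨hy, hyQ⟩)

theorem MMS_nonneg (hv : IsValuation M v) {n : ℕ} (hn : 0 < n) : 0 ≤ MMS M v n :=
  le_MMS hv hn (fun _ => ∅) (fun _ _ _ => Finset.disjoint_empty_left _)
    (fun _ => Finset.empty_subset M) (fun _ => hv.1.ge)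

theorem isLowerSet_value_lt (hv : IsValuation M v) {A : Finset α} (hA : A ⊆ M) (θ : ℝ) :
    IsLowerSet {S : Finset α | v (S ∩ A) < θ} := fun _ _ hTS hS =>
  (hv.2.1 _ _ (Finset.inter_subset_inter_right hTS)
    (Finset.inter_subset_right.trans hA)).trans_lt hS

/-- If all sets of at most `R` items are worth less than `θ`, then a random subset of density
`1 / d` of a bundle worth `3 d θ` is worth less than `θ` only with exponentially small
probability. -/
theorem sampleMean_value_lt_mul_lt_one (hv : IsValuation M v) {A : Finset α} (hA : A ⊆ M)
    {d R N : ℕ} (hd : 0 < d) {θ : ℝ} (hval : 3 * d * θ ≤ v A)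
    (hsmall : ∀ S ⊆ M, S.card ≤ R → v S < θ) (hR : d * N ^ 2 < 2 ^ (R + 1)) :
    sampleMean (1 / (d : ℝ)) A (Set.indicator {S | v (S ∩ A) < θ} 1) * N < 1 := by
  classical
  by_contra! hcon
  have hd1 : (1 : ℝ) ≤ d := by exact_mod_cast hd
  have hρ0 : (0 : ℝ) ≤ 1 / d := by positivity
  have hρ1 : 1 / (d : ℝ) ≤ 1 := by rw [div_le_one (by positivity)]; exact hd1
  set F : Set (Finset α) := {S | v (S ∩ A) < θ} with hF
  let h : Finset α → ℝ := fun x =>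
    if ∃ Y ∈ F, ∃ Z ∈ F, (x \ (Y ∪ Z)).card ≤ R then 0 else 2 ^ (R + 1)
  have hh0 : ∀ x, 0 ≤ h x := by
    intro x
    simp only [h]
    split_ifs <;> positivity
  have hT := sampleMean_mul_mul_le_one hρ0 hρ1 A F F (isLowerSet_value_lt hv hA θ)
    (isLowerSet_value_lt hv hA θ) h hh0 (by
      intro x Y hY Z hZ
      simp only [h]
      split_ifs with hx
      · positivity
      · push Not at hx
        exact pow_le_pow_right₀ one_le_two (hx Y hY Z hZ))
  have hEh := sampleMean_nonneg hρ0 hρ1 A hh0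
  generalize sampleMean (1 / (d : ℝ)) A (F.indicator 1) = μ at *
  have hE : sampleMean (1 / (d : ℝ)) A h ≤ (N : ℝ) ^ 2 := by
    have hN0 : (0 : ℝ) ≤ N := by positivity
    have h1 : 1 ≤ (μ * N) * (μ * N) := one_le_mul_of_one_le_of_one_le hcon hcon
    calc sampleMean (1 / (d : ℝ)) A h
        ≤ sampleMean (1 / (d : ℝ)) A h * ((μ * N) * (μ * N)) := le_mul_of_one_le_right hEh h1
      _ = (sampleMean (1 / (d : ℝ)) A h * μ * μ) * (N : ℝ) ^ 2 := by ring
      _ ≤ 1 * (N : ℝ) ^ 2 := by gcongr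
      _ = (N : ℝ) ^ 2 := one_mul _
  obtain ⟨φ, hφ⟩ := exists_coloring_sum_le hd A (fun _ : Fin d => A) (fun _ => subset_rfl)
    (fun c _ => c) (fun _ => h)
  have hsum : ∑ c : Fin d, h {e ∈ A | φ e = c} < 2 ^ (R + 1) := by
    refine hφ.trans_lt ?_
    simp only [Finset.sum_const, Finset.card_univ, Fintype.card_fin, nsmul_eq_mul]
    calc (d : ℝ) * sampleMean (1 / (d : ℝ)) A h ≤ d * (N : ℝ) ^ 2 := by gcongr
      _ < 2 ^ (R + 1) := by exact_mod_cast hR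
  have hclass : ∀ c : Fin d, v {e ∈ A | φ e = c} < 3 * θ := by
    intro c
    have hlt : h {e ∈ A | φ e = c} < 2 ^ (R + 1) :=
      (Finset.single_le_sum (f := fun c : Fin d => h {e ∈ A | φ e = c})
        (fun c _ => hh0 _) (Finset.mem_univ c)).trans_lt hsum
    simp only [h] at hlt
    split_ifs at hlt with hx
    · obtain ⟨Y, hY, Z, hZ, hc⟩ := hx
      have hTM : ({e ∈ A | φ e = c} \ (Y ∪ Z)) ⊆ M :=
        Finset.sdiff_subset.trans ((Finset.filter_subset _ _).trans hA)
      have hYM : Y ∩ A ⊆ M := Finset.inter_subset_right.trans hA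
      have hZM : Z ∩ A ⊆ M := Finset.inter_subset_right.trans hA
      have h1 := hsmall _ hTM hc
      have h2 : v (Y ∩ A) < θ := hY
      have h3 : v (Z ∩ A) < θ := hZ
      have h4 := hv.2.2 _ _ hYM hZM
      have h5 := hv.2.2 _ _ (Finset.union_subset hYM hZM) hTM
      have h6 : v {e ∈ A | φ e = c} ≤
          v (Y ∩ A ∪ Z ∩ A ∪ ({e ∈ A | φ e = c} \ (Y ∪ Z))) := by
        refine hv.2.1 _ _ (fun e he => ?_)
          (Finset.union_subset (Finset.union_subset hYM hZM) hTM)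
        simp only [Finset.mem_union, Finset.mem_inter, Finset.mem_sdiff, Finset.mem_filter] at he ⊢
        tauto
      linarith
    · exact absurd hlt (lt_irrefl _)
  have hcover : Finset.univ.biUnion (fun c : Fin d => {e ∈ A | φ e = c}) = A := by
    ext e; simp
  have hle := hv.biUnion_le Finset.univ (fun c : Fin d => {e ∈ A | φ e = c})
    (fun c _ => (Finset.filter_subset _ _).trans hA)
  rw [hcover] at hle
  have hlt : ∑ c : Fin d, v {e ∈ A | φ e = c} < ∑ _c : Fin d, 3 * θ :=
    Finset.sum_lt_sum_of_nonempty ⟨⟨0, hd⟩, Finset.mem_univ _⟩ fun c _ => hclass c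
  simp only [Finset.sum_const, Finset.card_univ, Fintype.card_fin, nsmul_eq_mul] at hlt
  linarith

theorem exists_injOn_fin {ι : Type*} (s : Finset ι) {d : ℕ} (hd : 0 < d) (hs : s.card ≤ d) :
    ∃ f : ι → Fin d, Set.InjOn f s := by
  classical
  refine ⟨fun i => if h : i ∈ s then Fin.castLE hs (s.equivFin ⟨i, h⟩) else ⟨0, hd⟩, ?_⟩
  intro i hi j hj hij
  have hi' : i ∈ s := hi
  have hj' : j ∈ s := hj
  simp only [hi', hj', dif_pos] at hij
  simpa using hij

/-- Rounding a `d`-multi-allocation to an allocation when small sets of items have small value. -/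
theorem exists_allocation_of_multiAllocation {ι : Type*} [Fintype ι] {d R : ℕ} (hd : 0 < d)
    {v : ι → Finset α → ℝ} (hv : ∀ i, IsValuation M (v i)) {θ : ι → ℝ} {A : ι → Finset α}
    (hA : ∀ i, A i ⊆ M) (hmul : ∀ e ∈ M, (Finset.univ.filter fun i => e ∈ A i).card ≤ d)
    (hval : ∀ i, 3 * d * θ i ≤ v i (A i))
    (hsmall : ∀ i, ∀ S ⊆ M, S.card ≤ R → v i S < θ i)
    (hR : d * Fintype.card ι ^ 2 < 2 ^ (R + 1)) :
    ∃ B : ι → Finset α, (∀ i, B i ⊆ A i) ∧ (∀ i j, i ≠ j → Disjoint (B i) (B j)) ∧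
      ∀ i, θ i ≤ v i (B i) := by
  have hidx : ∀ e, ∃ f : ι → Fin d,
      e ∈ M → Set.InjOn f (Finset.univ.filter fun i => e ∈ A i : Finset ι) := by
    intro e
    by_cases he : e ∈ M
    · obtain ⟨f, hf⟩ := exists_injOn_fin _ hd (hmul e he)
      exact ⟨f, fun _ => hf⟩
    · exact ⟨fun _ => ⟨0, hd⟩, fun h => absurd h he⟩
  choose idx hidx using hidx
  obtain ⟨φ, hφ⟩ := exists_coloring_sum_le hd M A hA (fun i e => idx e i)
    (fun i => Set.indicator {S | v i (S ∩ A i) < θ i} 1)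
  refine ⟨fun i => {e ∈ A i | φ e = idx e i}, fun i => Finset.filter_subset _ _, ?_, ?_⟩
  · intro i j hij
    refine Finset.disjoint_left.2 fun e hei hej => hij ?_
    rw [Finset.mem_filter] at hei hej
    exact hidx e (hA i hei.1) (by simpa using hei.1) (by simpa using hej.1)
      (hei.2.symm.trans hej.2)
  · intro i
    by_contra! hbad
    have hcard : (0 : ℝ) < Fintype.card ι := by
      exact_mod_cast Fintype.card_pos_iff.2 ⟨i⟩
    have hlt : ∑ i, sampleMean (1 / (d : ℝ)) (A i)
        (Set.indicator {S | v i (S ∩ A i) < θ i} 1) < ∑ _i : ι, 1 / (Fintype.card ι : ℝ) := by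
      refine Finset.sum_lt_sum_of_nonempty ⟨i, Finset.mem_univ i⟩ fun j _ => ?_
      rw [lt_div_iff₀ hcard]
      exact sampleMean_value_lt_mul_lt_one (hv j) (hA j) hd (hval j) (hsmall j) hR
    have hone : ∑ _i : ι, 1 / (Fintype.card ι : ℝ) = 1 := by
      simp [hcard.ne']
    have hge : (1 : ℝ) ≤ ∑ j, Set.indicator {S | v j (S ∩ A j) < θ j} (1 : Finset α → ℝ)
        {e ∈ A j | φ e = idx e j} := by
      refine le_trans (le_of_eq ?_) (Finset.single_le_sum (fun j _ =>
        Set.indicator_nonneg (fun _ _ => zero_le_one) _) (Finset.mem_univ i))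
      rw [Set.indicator_of_mem]
      rw [Set.mem_ofPred_eq, Finset.inter_eq_left.2 (Finset.filter_subset _ _)]
      exact hbad
    linarith

end Valuation

/-- Serve agents greedily by bundles of smallest cardinality: the agents in `K` receive disjoint
bundles of fewer than `R` items, and an agent outside `K` has no acceptable bundle of `r < R` items
avoiding the bundles of at most `r` items that were handed out. -/
theorem exists_greedy_allocation {α ι : Type*} [Fintype ι] [DecidableEq ι]
    (M : Finset α) (v : ι → Finset α → ℝ) (θ : ι → ℝ) (R : ℕ) :
    ∃ (K : Finset ι) (X : ι → Finset α),
      (∀ k ∈ K, X k ⊆ M ∧ (X k).card < R ∧ θ k ≤ v k (X k)) ∧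
      (∀ k ∈ K, ∀ l ∈ K, k ≠ l → Disjoint (X k) (X l)) ∧
      ∀ r < R, ∀ i ∉ K, ∀ S ⊆ M, S.card ≤ r →
        (∀ k ∈ K, (X k).card ≤ r → Disjoint S (X k)) → v i S < θ i := by
  classical
  induction R with
  | zero => exact ⟨∅, fun _ => ∅, by simp, by simp, by simp⟩
  | succ R ih =>
    obtain ⟨K₀, X₀, h1, h2, h3⟩ := ih
    let inv : Finset ι → Prop := fun K => ∃ X : ι → Finset α,
      (∀ k ∈ K, X k ⊆ M ∧ (X k).card < R + 1 ∧ θ k ≤ v k (X k)) ∧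
      (∀ k ∈ K, ∀ l ∈ K, k ≠ l → Disjoint (X k) (X l)) ∧
      ∀ r < R, ∀ i ∉ K, ∀ S ⊆ M, S.card ≤ r →
        (∀ k ∈ K, (X k).card ≤ r → Disjoint S (X k)) → v i S < θ i
    have hinv₀ : inv K₀ :=
      ⟨X₀, fun k hk => ⟨(h1 k hk).1, (h1 k hk).2.1.trans (Nat.lt_succ_self R), (h1 k hk).2.2⟩,
        h2, h3⟩
    obtain ⟨K, hK, hmax⟩ := Finset.exists_max_image (Finset.univ.filter inv) Finset.card
      ⟨K₀, by simpa using hinv₀⟩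
    obtain ⟨X, g1, g2, g3⟩ := (Finset.mem_filter.1 hK).2
    refine ⟨K, X, g1, g2, fun r hr i hi S hS hSr hSX => ?_⟩
    rcases (Nat.lt_succ_iff.1 hr).lt_or_eq with hlt | rfl
    · exact g3 r hlt i hi S hS hSr hSX
    by_contra! hgood
    have hne : ∀ k ∈ K, k ≠ i := fun k hk h => hi (h ▸ hk)
    have hSX' : ∀ k ∈ K, Disjoint S (X k) := fun k hk =>
      hSX k hk (Nat.lt_succ_iff.1 (g1 k hk).2.1)
    have hnew : inv (insert i K) := by
      refine ⟨Function.update X i S, ?_, ?_, ?_⟩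
      · intro k hk
        rcases Finset.mem_insert.1 hk with rfl | hk
        · simpa using ⟨hS, hSr, hgood⟩
        · rw [Function.update_of_ne (hne k hk)]
          exact g1 k hk
      · intro k hk l hl hkl
        rcases Finset.mem_insert.1 hk with rfl | hk' <;>
          rcases Finset.mem_insert.1 hl with rfl | hl'
        · exact absurd rfl hkl
        · rw [Function.update_self, Function.update_of_ne (hne l hl')]
          exact hSX' l hl'
        · rw [Function.update_self, Function.update_of_ne (hne k hk')]
          exact (hSX' k hk').symm
        · rw [Function.update_of_ne (hne k hk'), Function.update_of_ne (hne l hl')]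
          exact g2 k hk' l hl' hkl
      · intro r hr j hj T hT hTr hTX
        refine g3 r hr j (fun h => hj (Finset.mem_insert_of_mem h)) T hT hTr fun k hk hkr => ?_
        have := hTX k (Finset.mem_insert_of_mem hk)
        rw [Function.update_of_ne (hne k hk)] at this
        exact this hkr
    have := hmax _ (Finset.mem_filter.2 ⟨Finset.mem_univ _, hnew⟩)
    rw [Finset.card_insert_of_notMem hi] at this
    omega

section Greedy

variable {α : Type*} [DecidableEq α]

/-- The share of the bundles `X k`, `k ∈ K`, that lies in `Y`. -/
noncomputable def overlap {ι : Type*} (K : Finset ι) (X : ι → Finset α) (Y : Finset α) : ℝ :=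
  ∑ k ∈ K, ((Y ∩ X k).card : ℝ) / (X k).card

/-- At least `n - |K|` out of `n` disjoint bundles have overlap less than `1`. -/
theorem le_card_overlap_lt_one {ι : Type*} {n : ℕ} (K : Finset ι) (X : ι → Finset α)
    (P : Fin n → Finset α) (hP : ∀ i j, i ≠ j → Disjoint (P i) (P j)) :
    n - K.card ≤ (Finset.univ.filter fun b => overlap K X (P b) < 1).card := by
  have htotal : ∑ b, overlap K X (P b) ≤ K.card := by
    unfold overlap
    rw [Finset.sum_comm]
    refine (Finset.sum_le_card_nsmul K _ 1 fun k _ => ?_).trans (by simp)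
    rw [← Finset.sum_div]
    refine div_le_one_of_le₀ ?_ (Nat.cast_nonneg _)
    rw [← Nat.cast_sum, ← Finset.card_biUnion]
    · exact_mod_cast Finset.card_le_card
        (Finset.biUnion_subset.2 fun b _ => Finset.inter_subset_right)
    · intro i _ j _ hij
      exact (hP i j hij).mono Finset.inter_subset_left Finset.inter_subset_left
  have hheavy : ((Finset.univ.filter fun b => ¬ overlap K X (P b) < 1).card : ℝ) ≤ K.card := by
    refine le_trans ?_ htotal
    have h1 : ((Finset.univ.filter fun b => ¬ overlap K X (P b) < 1).card : ℝ) ≤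
        ∑ b ∈ Finset.univ.filter fun b => ¬ overlap K X (P b) < 1, overlap K X (P b) := by
      have := Finset.card_nsmul_le_sum (Finset.univ.filter fun b => ¬ overlap K X (P b) < 1)
        (fun b => overlap K X (P b)) 1 (fun b hb => not_lt.1 (Finset.mem_filter.1 hb).2)
      simpa using this
    refine h1.trans (Finset.sum_le_sum_of_subset_of_nonneg (Finset.filter_subset _ _) ?_)
    intro b _ _
    exact Finset.sum_nonneg fun k _ => by positivity
  have hheavy' : (Finset.univ.filter fun b => ¬ overlap K X (P b) < 1).card ≤ K.card := by
    exact_mod_cast hheavy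
  have := Finset.card_filter_add_card_filter_not (s := Finset.univ)
    (fun b => overlap K X (P b) < 1)
  rw [Finset.card_univ, Fintype.card_fin] at this
  omega

theorem value_inter_biUnion_le {ι : Type*} {M : Finset α} {v : Finset α → ℝ}
    (hv : IsValuation M v) {θ : ℝ} (hθ : 0 ≤ θ) {J : ℕ} {K : Finset ι} {X : ι → Finset α}
    (hcard : ∀ k ∈ K, (X k).card ≤ 2 ^ J)
    (hdisj : ∀ k ∈ K, ∀ l ∈ K, k ≠ l → Disjoint (X k) (X l))
    (hsat : ∀ j < J, ∀ S ⊆ M, S.card ≤ 2 ^ j →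
      (∀ k ∈ K, (X k).card ≤ 2 ^ j → Disjoint S (X k)) → v S < θ)
    {Y : Finset α} (hY : Y ⊆ M) (hw : overlap K X Y < 1) :
    v (Y ∩ K.biUnion X) ≤ (J + 1) * θ := by
  classical
  let C : ℕ → Finset ι := fun j => K.filter fun k => Nat.clog 2 (X k).card = j + 1
  let Z : ℕ → Finset α := fun j => (C j).biUnion fun k => Y ∩ X k
  let w : ℕ → ℝ := fun j => overlap (C j) X Y
  have hw0 : ∀ j, 0 ≤ w j := fun j => Finset.sum_nonneg fun k _ => by positivity
  have hC : ∀ j, ∀ k ∈ C j, k ∈ K ∧ 2 ^ j < (X k).card ∧ (X k).card ≤ 2 ^ (j + 1) := by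
    intro j k hk
    obtain ⟨hkK, hk⟩ := Finset.mem_filter.1 hk
    refine ⟨hkK, ?_, (Nat.clog_le_iff_le_pow one_lt_two).1 hk.le⟩
    by_contra! h
    have := (Nat.clog_le_iff_le_pow one_lt_two).2 h
    omega
  have hwsum : ∑ j ∈ Finset.range J, w j < 1 := by
    refine lt_of_le_of_lt ?_ hw
    change ∑ j ∈ Finset.range J, ∑ k ∈ C j, ((Y ∩ X k).card : ℝ) / (X k).card ≤
      ∑ k ∈ K, ((Y ∩ X k).card : ℝ) / (X k).card
    rw [← Finset.sum_biUnion]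
    · refine Finset.sum_le_sum_of_subset_of_nonneg
        (Finset.biUnion_subset.2 fun j _ => Finset.filter_subset _ _) fun k _ _ => by positivity
    · intro i _ j _ hij
      refine Finset.disjoint_left.2 fun k hi hj => hij ?_
      have h1 := (Finset.mem_filter.1 hi).2
      have h2 := (Finset.mem_filter.1 hj).2
      omega
  have hZcard : ∀ j, ((Z j).card : ℝ) ≤ 2 ^ (j + 1) * w j := by
    intro j
    have h1 : ((Z j).card : ℝ) ≤ ∑ k ∈ C j, ((Y ∩ X k).card : ℝ) := by
      exact_mod_cast Finset.card_biUnion_le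
    refine h1.trans ?_
    simp only [w, overlap]
    rw [Finset.mul_sum]
    refine Finset.sum_le_sum fun k hk => ?_
    obtain ⟨-, hlo, hhi⟩ := hC j k hk
    have hpos : (0 : ℝ) < (X k).card := by exact_mod_cast (Nat.zero_le _).trans_lt hlo
    have hhi' : ((X k).card : ℝ) ≤ 2 ^ (j + 1) := by exact_mod_cast hhi
    rw [← mul_div_assoc, le_div_iff₀ hpos, mul_comm]
    gcongr
  have hZM : ∀ j, Z j ⊆ M := fun j =>
    Finset.biUnion_subset.2 fun k _ => Finset.inter_subset_left.trans hY
  have hbad : ∀ j < J, ∀ S ⊆ Z j, S.card ≤ 2 ^ j → v S < θ := by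
    intro j hj S hS hSc
    refine hsat j hj S (hS.trans (hZM j)) hSc fun l hl hlc => ?_
    refine Finset.disjoint_of_subset_left hS ?_
    refine (Finset.disjoint_biUnion_left _ _ _).2 fun k hk => ?_
    obtain ⟨hkK, hlo, -⟩ := hC j k hk
    refine (hdisj k hkK l hl ?_).mono_left Finset.inter_subset_right
    rintro rfl
    omega
  have hZv : ∀ j ∈ Finset.range J, v (Z j) ≤ θ + if 1 / 2 < w j then θ else 0 := by
    intro j hj
    have hj := Finset.mem_range.1 hj
    by_cases hc : (Z j).card ≤ 2 ^ j
    · have := hbad j hj (Z j) subset_rfl hc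
      split_ifs <;> linarith
    have hZc := hZcard j
    have hwj : w j < 1 := (Finset.single_le_sum (fun j _ => hw0 j)
      (Finset.mem_range.2 hj)).trans_lt hwsum
    have h2j : (0 : ℝ) < 2 ^ j := by positivity
    have hcR : (2 : ℝ) ^ j < (Z j).card := by exact_mod_cast not_le.1 hc
    have hhalf : 1 / 2 < w j := by
      rw [pow_succ] at hZc
      nlinarith
    have hlt : (Z j).card < 2 ^ (j + 1) := by
      have : ((Z j).card : ℝ) < 2 ^ (j + 1) := by
        rw [pow_succ] at hZc ⊢
        nlinarith
      exact_mod_cast this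
    obtain ⟨T, hT, hTc⟩ := Finset.exists_subset_card_eq (not_le.1 hc).le
    have h1 := hbad j hj T hT hTc.le
    have h2 := hbad j hj (Z j \ T) Finset.sdiff_subset (by
      rw [Finset.card_sdiff_of_subset hT, hTc]
      rw [pow_succ] at hlt
      omega)
    have h3 := hv.2.2 T (Z j \ T) (hT.trans (hZM j)) (Finset.sdiff_subset.trans (hZM j))
    rw [Finset.union_sdiff_of_subset hT] at h3
    rw [if_pos hhalf]
    linarith
  have hone : ∑ j ∈ Finset.range J, (if 1 / 2 < w j then θ else 0) ≤ θ := by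
    rw [← Finset.sum_filter, Finset.sum_const, nsmul_eq_mul]
    have : ((Finset.range J).filter fun j => 1 / 2 < w j).card ≤ 1 := by
      refine Finset.card_le_one.2 fun a ha b hb => ?_
      by_contra hab
      obtain ⟨haJ, ha⟩ := Finset.mem_filter.1 ha
      obtain ⟨hbJ, hb⟩ := Finset.mem_filter.1 hb
      have h1 := Finset.sum_le_sum_of_subset_of_nonneg (s := {a, b}) (t := Finset.range J)
        (f := w) (by
          intro x hx
          rcases Finset.mem_insert.1 hx with rfl | hx
          · exact haJ
          · rwa [Finset.mem_singleton.1 hx]) (fun j _ _ => hw0 j)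
      rw [Finset.sum_pair hab] at h1
      linarith
    exact mul_le_of_le_one_left hθ (by exact_mod_cast this)
  have hcover : Y ∩ K.biUnion X ⊆ (Finset.range J).biUnion Z := by
    intro e he
    obtain ⟨heY, heX⟩ := Finset.mem_inter.1 he
    obtain ⟨k, hk, hek⟩ := Finset.mem_biUnion.1 heX
    have hlarge : 1 < (X k).card := by
      by_contra! hle
      have h1 : (X k).card = 1 := le_antisymm hle (Finset.card_pos.2 ⟨e, hek⟩)
      have h2 : 1 ≤ (Y ∩ X k).card := Finset.card_pos.2 ⟨e, Finset.mem_inter.2 ⟨heY, hek⟩⟩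
      have h3 : ((Y ∩ X k).card : ℝ) / (X k).card ≤ overlap K X Y :=
        Finset.single_le_sum (f := fun k => ((Y ∩ X k).card : ℝ) / (X k).card)
          (fun k _ => by positivity) hk
      have h4 : (1 : ℝ) ≤ (Y ∩ X k).card := by exact_mod_cast h2
      rw [h1, Nat.cast_one, div_one] at h3
      linarith
    have hpos : 0 < Nat.clog 2 (X k).card := Nat.clog_pos one_lt_two hlarge
    have hleJ : Nat.clog 2 (X k).card ≤ J := (Nat.clog_le_iff_le_pow one_lt_two).2 (hcard k hk)
    refine Finset.mem_biUnion.2 ⟨Nat.clog 2 (X k).card - 1, Finset.mem_range.2 (by omega), ?_⟩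
    refine Finset.mem_biUnion.2 ⟨k, Finset.mem_filter.2 ⟨hk, by omega⟩, ?_⟩
    exact Finset.mem_inter.2 ⟨heY, hek⟩
  calc v (Y ∩ K.biUnion X) ≤ v ((Finset.range J).biUnion Z) :=
        hv.2.1 _ _ hcover (Finset.biUnion_subset.2 fun j _ => hZM j)
    _ ≤ ∑ j ∈ Finset.range J, v (Z j) := hv.biUnion_le _ _ fun j _ => hZM j
    _ ≤ ∑ j ∈ Finset.range J, (θ + if 1 / 2 < w j then θ else 0) := Finset.sum_le_sum hZv
    _ ≤ (J + 1) * θ := by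
      rw [Finset.sum_add_distrib, Finset.sum_const, Finset.card_range, nsmul_eq_mul]
      linarith

end Greedy

theorem two_pow_two_pow_lt_nSeq : ∀ d : ℕ, 2 ^ 2 ^ (d + 1) < nSeq (d + 2)
  | 0 => by decide
  | d + 1 => by
    have ih := two_pow_two_pow_lt_nSeq d
    have h : nSeq (d + 1 + 2) = nSeq (d + 2) * (nSeq (d + 2) + 1) := rfl
    rw [h, pow_succ 2 (d + 1), pow_mul, sq]
    exact Nat.mul_lt_mul'' ih (ih.trans (Nat.lt_succ_self _))

theorem le_two_pow_two_pow_of_ceil_logb {n c : ℕ} (hn : 4 ≤ n)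
    (hc : Real.logb 2 (Real.logb 2 (n : ℝ)) ≤ c) : n ≤ 2 ^ 2 ^ c := by
  have hn' : (4 : ℝ) ≤ n := by exact_mod_cast hn
  have hlog : 0 < Real.logb 2 (n : ℝ) := Real.logb_pos one_lt_two (by linarith)
  have h1 := (Real.logb_le_iff_le_rpow one_lt_two hlog).1 hc
  rw [Real.rpow_natCast] at h1
  have h2 := (Real.logb_le_iff_le_rpow one_lt_two (by linarith)).1 h1
  have h3 : (n : ℝ) ≤ 2 ^ (2 ^ c : ℕ) := by
    rw [← Real.rpow_natCast]
    exact_mod_cast h2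
  exact_mod_cast h3

theorem one_le_logb_logb {n : ℕ} (hn : 4 ≤ n) : 1 ≤ Real.logb 2 (Real.logb 2 (n : ℝ)) := by
  have hn' : (4 : ℝ) ≤ n := by exact_mod_cast hn
  have h1 : 2 ≤ Real.logb 2 (n : ℝ) := by
    rw [Real.le_logb_iff_rpow_le one_lt_two (by linarith)]
    norm_num
    exact hn
  rw [Real.le_logb_iff_rpow_le one_lt_two (by linarith)]
  simpa using h1

/-- If `1/2`-MMS `d`-multi-allocations exist for at most `n` agents, then `1/(8d)`-MMS
allocations exist for `n` agents. -/
theorem exists_allocation_of_halfMMS_multiAllocation {α : Type*} [DecidableEq α] {d n : ℕ}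
    (hd : 2 ≤ d) (hn : n ≤ 2 ^ 2 ^ (d - 1))
    (H : ∀ (M : Finset α) (m : ℕ), m ≤ n → ∀ (v : Fin m → Finset α → ℝ),
      (∀ i, IsValuation M (v i)) →
      ∃ A : Fin m → Finset α, (∀ i, A i ⊆ M) ∧
        (∀ e ∈ M, (Finset.univ.filter fun i => e ∈ A i).card ≤ d) ∧
        ∀ i, v i (A i) ≥ (1 / 2) * MMS M (v i) m)
    (M : Finset α) (v : Fin n → Finset α → ℝ) (hv : ∀ i, IsValuation M (v i)) :
    ∃ A : Fin n → Finset α, (∀ i, A i ⊆ M) ∧ (∀ i j, i ≠ j → Disjoint (A i) (A j)) ∧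
      ∀ i, MMS M (v i) n / (8 * d) ≤ v i (A i) := by
  have hdR : (2 : ℝ) ≤ d := by exact_mod_cast hd
  obtain ⟨θ, hθ⟩ : ∃ θ : Fin n → ℝ, ∀ i, θ i = MMS M (v i) n / (8 * d) := ⟨_, fun _ => rfl⟩
  have hθ0 : ∀ i, 0 ≤ θ i := by
    intro i
    rw [hθ]
    exact div_nonneg (MMS_nonneg (hv i) i.pos) (by positivity)
  simp only [← hθ]
  obtain ⟨K, X, hX, hXdisj, hsat⟩ := exists_greedy_allocation M v θ (2 ^ (d + 1) + 1)
  set M' := M \ K.biUnion X with hM'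
  have hM'M : M' ⊆ M := Finset.sdiff_subset
  let ag := Kᶜ.orderEmbOfFin rfl
  have hag : ∀ t, ag t ∉ K := fun t =>
    Finset.mem_compl.1 (Finset.orderEmbOfFin_mem Kᶜ rfl t)
  have hsurj : ∀ i, i ∉ K → ∃ t, ag t = i := by
    intro i hi
    have : i ∈ Set.range ag := by
      rw [Finset.range_orderEmbOfFin]
      simpa using hi
    exact this
  have hm : Kᶜ.card = n - K.card := by rw [Finset.card_compl, Fintype.card_fin]
  have hmn : Kᶜ.card ≤ n := by omega
  have hvM' : ∀ t, IsValuation M' (v (ag t)) := fun t => (hv _).mono_set hM'M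
  have hMMS : ∀ t, 6 * d * θ (ag t) ≤ MMS M' (v (ag t)) Kᶜ.card := by
    intro t
    have hvt := hv (ag t)
    obtain ⟨P, hPdisj, hPM, hPv⟩ := exists_partition_MMS_le M (v (ag t)) (ag t).pos
    have hlight := le_card_overlap_lt_one K X P hPdisj
    rw [← hm] at hlight
    let g := Finset.orderEmbOfCardLe _ hlight
    have hg : ∀ b, overlap K X (P (g b)) < 1 := fun b =>
      (Finset.mem_filter.1 (Finset.orderEmbOfCardLe_mem _ hlight b)).2
    refine le_MMS (hvM' t) t.pos (fun b => P (g b) \ K.biUnion X) ?_ ?_ ?_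
    · intro a b hab
      exact (hPdisj _ _ fun h => hab (g.injective h)).mono Finset.sdiff_subset Finset.sdiff_subset
    · exact fun b => Finset.sdiff_subset_sdiff (hPM _) subset_rfl
    · intro b
      have hlost := value_inter_biUnion_le hvt (hθ0 (ag t)) (J := d + 1)
        (fun k hk => Nat.lt_succ_iff.1 (hX k hk).2.1) hXdisj
        (fun j hj S hS hSc hSX => hsat (2 ^ j)
          (Nat.lt_succ_iff.2 (Nat.pow_le_pow_right two_pos hj.le)) _ (hag t) S hS hSc hSX)
        (hPM (g b)) (hg b)
      have hsplit := hvt.2.2 (P (g b) \ K.biUnion X) (P (g b) ∩ K.biUnion X)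
        (Finset.sdiff_subset.trans (hPM _)) (Finset.inter_subset_left.trans (hPM _))
      rw [Finset.sdiff_union_inter] at hsplit
      have hμ : 8 * d * θ (ag t) = MMS M (v (ag t)) n := by
        rw [hθ]
        field_simp
      have := hPv (g b)
      push_cast at hlost
      nlinarith [mul_nonneg (sub_nonneg.2 hdR) (hθ0 (ag t))]
  obtain ⟨A, hAM, hAmul, hAv⟩ := H M' Kᶜ.card hmn (fun t => v (ag t)) hvM'
  have hR : d * Fintype.card (Fin Kᶜ.card) ^ 2 < 2 ^ (2 ^ (d + 1) + 1) := by
    rw [Fintype.card_fin]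
    have h1 : Kᶜ.card ^ 2 ≤ 2 ^ 2 ^ d := by
      calc Kᶜ.card ^ 2 ≤ (2 ^ 2 ^ (d - 1)) ^ 2 := Nat.pow_le_pow_left (hmn.trans hn) 2
        _ = 2 ^ 2 ^ d := by
          rw [← pow_mul, ← pow_succ, Nat.sub_add_cancel (by omega)]
    have h2 : d < 2 ^ 2 ^ d := Nat.lt_two_pow_self.trans Nat.lt_two_pow_self
    have h3 : 2 ^ (2 ^ (d + 1) + 1) = 2 ^ 2 ^ d * 2 ^ 2 ^ d * 2 := by
      rw [← pow_add, ← mul_two, ← pow_succ 2 d, ← pow_succ]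
    rw [h3]
    nlinarith
  obtain ⟨B, hBA, hBdisj, hBv⟩ := exists_allocation_of_multiAllocation (d := d)
    (R := 2 ^ (d + 1)) (by omega) hvM' (θ := fun t => θ (ag t)) hAM hAmul
    (fun t => by have := hAv t; have := hMMS t; linarith)
    (fun t S hS hSc => hsat _ (Nat.lt_succ_self _) _ (hag t) S (hS.trans hM'M) hSc
      fun k hk _ => Finset.disjoint_of_subset_right (Finset.subset_biUnion_of_mem X hk)
        (Finset.disjoint_of_subset_left hS Finset.sdiff_disjoint)) hR
  choose inv hinv using hsurj
  have hXB : ∀ k ∈ K, ∀ t, Disjoint (X k) (B t) := fun k hk t =>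
    Finset.disjoint_of_subset_left (Finset.subset_biUnion_of_mem X hk)
      (Finset.disjoint_of_subset_right ((hBA t).trans (hAM t)) Finset.disjoint_sdiff)
  refine ⟨fun i => if h : i ∈ K then X i else B (inv i h), ?_, ?_, ?_⟩
  · intro i
    dsimp only
    split_ifs with h
    · exact (hX i h).1
    · exact ((hBA _).trans (hAM _)).trans hM'M
  · intro i j hij
    dsimp only
    split_ifs with hi hj hj
    · exact hXdisj i hi j hj hij
    · exact hXB i hi _
    · exact (hXB j hj _).symm
    · refine hBdisj _ _ fun h => hij ?_
      rw [← hinv i hi, ← hinv j hj, h]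
  · intro i
    dsimp only
    split_ifs with h
    · exact (hX i h).2.2
    · have := hBv (inv i h)
      rwa [hinv i h] at this

theorem stmt4
    (H : ∀ d : ℕ, 1 ≤ d → ∀ (β : Type u) [DecidableEq β] (M : Finset β) (n : ℕ),
      n < nSeq d → ∀ (v : Fin n → Finset β → ℝ), (∀ i, IsValuation M (v i)) →
      ∃ A : Fin n → Finset β, (∀ i, A i ⊆ M) ∧
        (∀ e ∈ M, (Finset.univ.filter fun i => e ∈ A i).card ≤ d) ∧
        ∀ i, v i (A i) ≥ (1 / 2) * MMS M (v i) n) :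
    ∀ (α : Type u) [DecidableEq α] (M : Finset α) (n : ℕ), 4 ≤ n →
      ∀ (v : Fin n → Finset α → ℝ), (∀ i, IsValuation M (v i)) →
      ∃ A : Fin n → Finset α, (∀ i, A i ⊆ M) ∧
        (∀ i j, i ≠ j → Disjoint (A i) (A j)) ∧
        ∀ i, v i (A i) ≥
          MMS M (v i) n /
            (8 * ((⌈Real.logb 2 (Real.logb 2 (n : ℝ))⌉ : ℝ) + 1)) := by
  intro α _ M n hn v hv
  have hlog := one_le_logb_logb hn
  obtain ⟨c, hc⟩ : ∃ c : ℕ, ⌈Real.logb 2 (Real.logb 2 (n : ℝ))⌉ = c :=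
    Int.eq_ofNat_of_zero_le (Int.ceil_nonneg (by linarith))
  have hle : Real.logb 2 (Real.logb 2 (n : ℝ)) ≤ c := by
    have := Int.le_ceil (Real.logb 2 (Real.logb 2 (n : ℝ)))
    rw [hc] at this
    exact_mod_cast this
  have hc1 : 1 ≤ c := by exact_mod_cast hlog.trans hle
  have hnc : n ≤ 2 ^ 2 ^ c := le_two_pow_two_pow_of_ceil_logb hn hle
  have hlt : n < nSeq (c + 1) := by
    obtain ⟨d, rfl⟩ := Nat.exists_eq_add_of_le' hc1
    exact hnc.trans_lt (two_pow_two_pow_lt_nSeq d)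
  obtain ⟨A, hA, hdisj, hval⟩ := exists_allocation_of_halfMMS_multiAllocation (d := c + 1)
    (by omega) hnc
    (fun M m hm v hv => H (c + 1) (by omega) α M m (hm.trans_lt hlt) v hv) M v hv
  refine ⟨A, hA, hdisj, fun i => ?_⟩
  have := hval i
  rw [hc]
  push_cast at this ⊢
  exact this
end

section
/- Let M be a finite set of items and let v be a normalized, monotone, subadditive valuation on M. Then ω(S_p, M, v) ≥ (1/2)·v(M). -/
open Finset

/-- The value, for player `p`, of the alternating picking game with `v` the valuation of `p`,
`R` the remaining items, `T` the set of items already picked by `p`, where the Bool indicates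
whether it is `p`'s turn (`true`) or `q`'s turn (`false`). The first (fuel) argument is
intended to be `R.card`, so the recursion bottoms out exactly when `R = ∅`. -/
noncomputable def pickVal {α : Type*} [DecidableEq α] (v : Finset α → ℝ) :
    ℕ → Bool → Finset α → Finset α → ℝ
  | 0, _, _, T => v T
  | k + 1, b, R, T =>
    if hR : R.Nonempty then
      if b then
        (R.image fun e => pickVal v k false (R.erase e) (insert e T)).max' (hR.image _)
      else
        (R.image fun e => pickVal v k true (R.erase e) T).min' (hR.image _)
    else v T

/-- `ω(S_p, M, v)`: the maximin value that player `p` can guarantee in the alternating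
picking game over `M` in which `p` picks first. -/
noncomputable def omegaP {α : Type*} [DecidableEq α] (M : Finset α) (v : Finset α → ℝ) : ℝ :=
  pickVal v M.card true M ∅

/-- `ω(S_q, M, v)`: the maximin value that player `p` can guarantee in the alternating
picking game over `M` in which `q` picks first. -/
noncomputable def omegaQ {α : Type*} [DecidableEq α] (M : Finset α) (v : Finset α → ℝ) : ℝ :=
  pickVal v M.card false M ∅

section PickingGame

variable {α : Type*} [DecidableEq α] {v : Finset α → ℝ} {k : ℕ} {M R T U : Finset α}

lemma le_pickVal_true {e : α} (he : e ∈ R) :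
    pickVal v k false (R.erase e) (insert e T) ≤ pickVal v (k + 1) true R T := by
  have hR : R.Nonempty := ⟨e, he⟩
  simp only [pickVal, hR, dif_pos, if_true]
  exact le_max' _ _
    (mem_image_of_mem (fun e => pickVal v k false (R.erase e) (insert e T)) he)

lemma pickVal_false_le {e : α} (he : e ∈ R) :
    pickVal v (k + 1) false R T ≤ pickVal v k true (R.erase e) T := by
  have hR : R.Nonempty := ⟨e, he⟩
  simp only [pickVal, hR, dif_pos, Bool.false_eq_true, if_false]
  exact min'_le _ _ (mem_image_of_mem (fun e => pickVal v k true (R.erase e) T) he)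

lemma exists_pickVal_true_eq (hR : R.Nonempty) :
    ∃ e ∈ R, pickVal v (k + 1) true R T = pickVal v k false (R.erase e) (insert e T) := by
  obtain ⟨e, he, h⟩ := mem_image.1 (max'_mem
    (R.image fun e => pickVal v k false (R.erase e) (insert e T)) (hR.image _))
  refine ⟨e, he, ?_⟩
  simp only [pickVal, hR, dif_pos, if_true]
  exact h.symm

lemma exists_pickVal_false_eq (hR : R.Nonempty) :
    ∃ e ∈ R, pickVal v (k + 1) false R T = pickVal v k true (R.erase e) T := by
  obtain ⟨e, he, h⟩ := mem_image.1 (min'_mem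
    (R.image fun e => pickVal v k true (R.erase e) T) (hR.image _))
  refine ⟨e, he, ?_⟩
  simp only [pickVal, hR, dif_pos, Bool.false_eq_true, if_false]
  exact h.symm

/-- The values the two roles can secure, evaluated with the same subadditive valuation,
together cover the value of all items. -/
lemma le_pickVal_true_add_pickVal_false
    (hsub : ∀ S T : Finset α, S ⊆ M → T ⊆ M → v (S ∪ T) ≤ v S + v T)
    (hk : R.card = k) (hM : R ∪ T ∪ U = M) :
    v M ≤ pickVal v k true R T + pickVal v k false R U := by
  induction k generalizing R T U with
  | zero =>
    obtain rfl := card_eq_zero.1 hk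
    rw [empty_union] at hM
    subst hM
    exact hsub T U subset_union_left subset_union_right
  | succ k ih =>
    obtain ⟨e, he, h⟩ := exists_pickVal_false_eq (v := v) (k := k) (T := U)
      (card_pos.1 (by omega : 0 < R.card))
    have hcard : (R.erase e).card = k := by rw [card_erase_of_mem he]; omega
    have hunion : R.erase e ∪ U ∪ insert e T = M := by
      subst hM
      ext a
      by_cases ha : a = e <;> simp [ha, he]; tauto
    rw [h]
    linarith [ih hcard hunion, le_pickVal_true (v := v) (k := k) (T := T) he]

/-- Moving first is at least as good as moving second, and already owning a remaining item is
at least as good as having it still on the table. -/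
lemma pickVal_false_le_true_and_le_erase_insert
    (hmono : ∀ S T : Finset α, S ⊆ T → T ⊆ M → v S ≤ v T)
    (hk : R.card = k) (hM : R ∪ T ⊆ M) :
    pickVal v k false R T ≤ pickVal v k true R T ∧
      ∀ x ∈ R, ∀ b, pickVal v k b R T ≤ pickVal v (k - 1) b (R.erase x) (insert x T) := by
  induction k generalizing R T with
  | zero =>
    obtain rfl := card_eq_zero.1 hk
    simp [pickVal]
  | succ k ih =>
    have hcard {e : α} (he : e ∈ R) : (R.erase e).card = k := by
      rw [card_erase_of_mem he]; omega
    have hskip {e : α} : R.erase e ∪ T ⊆ M :=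
      (union_subset_union_left (erase_subset e R)).trans hM
    have htake {e : α} (he : e ∈ R) : R.erase e ∪ insert e T ⊆ M := by
      rwa [union_insert, ← insert_union, insert_erase he]
    have hfalse : ∀ x ∈ R,
        pickVal v (k + 1) false R T ≤ pickVal v k false (R.erase x) (insert x T) := by
      intro x hx
      rcases k with _ | k
      · refine (pickVal_false_le hx).trans ?_
        exact hmono _ _ (subset_insert x T) (subset_union_right.trans (htake hx))
      · obtain ⟨y, hy, h⟩ := exists_pickVal_false_eq (v := v) (k := k) (T := insert x T)
          (card_pos.1 (by rw [hcard hx]; omega : 0 < (R.erase x).card))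
        have hyR := mem_of_mem_erase hy
        rw [h, erase_right_comm]
        exact (pickVal_false_le hyR).trans
          ((ih (hcard hyR) hskip).2 x (mem_erase.2 ⟨(ne_of_mem_erase hy).symm, hx⟩) true)
    refine ⟨?_, fun x hx b => ?_⟩
    · obtain ⟨x, hx⟩ := card_pos.1 (by omega : 0 < R.card)
      exact (hfalse x hx).trans (le_pickVal_true hx)
    · cases b with
      | false => exact hfalse x hx
      | true =>
        obtain ⟨e, he, h⟩ := exists_pickVal_true_eq (v := v) (k := k) (T := T) ⟨x, hx⟩
        rw [h]
        by_cases hex : e = x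
        · subst hex
          exact (ih (hcard he) (htake he)).1
        · have hxe : x ∈ R.erase e := mem_erase.2 ⟨Ne.symm hex, hx⟩
          have hpos : 0 < k := hcard he ▸ card_pos.2 ⟨x, hxe⟩
          obtain ⟨k, rfl⟩ := Nat.exists_eq_add_one.2 hpos
          refine ((ih (hcard he) (htake he)).2 x hxe false).trans ?_
          rw [erase_right_comm, insert_comm]
          exact le_pickVal_true (mem_erase.2 ⟨hex, he⟩)

end PickingGame

theorem stmt8 {α : Type*} [DecidableEq α] (M : Finset α) (v : Finset α → ℝ)
    (hv : IsValuation M v) :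
    omegaP M v ≥ (1 / 2) * v M := by
  obtain ⟨-, hmono, hsub⟩ := hv
  have hcover : v M ≤ omegaP M v + omegaQ M v :=
    le_pickVal_true_add_pickVal_false hsub rfl (by simp)
  have hfirst : omegaQ M v ≤ omegaP M v :=
    (pickVal_false_le_true_and_le_erase_insert hmono rfl (by simp)).1
  linarith
end

section
/- In every multi-graph allocation instance on n agents with a finite item set M in which every agent i has a normalized, monotone valuation v_i on M satisfying v_i(S) = v_i(S ∩ M^i) for all S ⊆ M, there exists an orientation allocation in which every agent i receives a bundle A_i with v_i(A_i) ≥ ω(S_q, M^i, v_i), where ω(S_q, M^i, v_i) is the maximin value for agent i as player p in the alternating picking game over M^i in which the opponent picks first. -/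
open Finset

/-- The value of the picking game started from `R` with `T` already picked; `b` tells whether it is
the turn of the player whose valuation is `v`. -/
noncomputable def gameVal {α : Type*} [DecidableEq α] (v : Finset α → ℝ) (b : Bool)
    (R T : Finset α) : ℝ :=
  pickVal v R.card b R T

section GameVal

variable {α : Type*} [DecidableEq α] (v : Finset α → ℝ)

theorem gameVal_empty (b : Bool) (T : Finset α) : gameVal v b ∅ T = v T := by
  simp [gameVal, pickVal]

theorem gameVal_true_eq_max' {R : Finset α} (hR : R.Nonempty) (T : Finset α) :
    gameVal v true R T =
      (R.image fun e => gameVal v false (R.erase e) (insert e T)).max' (hR.image _) := by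
  have h : (R.image fun e => gameVal v false (R.erase e) (insert e T)) =
      R.image fun e => pickVal v (R.card - 1) false (R.erase e) (insert e T) :=
    Finset.image_congr fun e he => by simp [gameVal, Finset.card_erase_of_mem (Finset.mem_coe.1 he)]
  obtain ⟨k, hk⟩ := Nat.exists_eq_succ_of_ne_zero hR.card_pos.ne'
  simp only [h]
  simp [gameVal, hk, pickVal, hR]

theorem gameVal_false_eq_min' {R : Finset α} (hR : R.Nonempty) (T : Finset α) :
    gameVal v false R T =
      (R.image fun e => gameVal v true (R.erase e) T).min' (hR.image _) := by
  have h : (R.image fun e => gameVal v true (R.erase e) T) =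
      R.image fun e => pickVal v (R.card - 1) true (R.erase e) T :=
    Finset.image_congr fun e he => by simp [gameVal, Finset.card_erase_of_mem (Finset.mem_coe.1 he)]
  obtain ⟨k, hk⟩ := Nat.exists_eq_succ_of_ne_zero hR.card_pos.ne'
  simp only [h]
  simp [gameVal, hk, pickVal, hR]

theorem exists_gameVal_true_eq {R : Finset α} (hR : R.Nonempty) (T : Finset α) :
    ∃ e ∈ R, gameVal v false (R.erase e) (insert e T) = gameVal v true R T := by
  rw [gameVal_true_eq_max' v hR]
  exact Finset.mem_image.1 (Finset.max'_mem _ _)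

theorem exists_gameVal_false_eq {R : Finset α} (hR : R.Nonempty) (T : Finset α) :
    ∃ e ∈ R, gameVal v true (R.erase e) T = gameVal v false R T := by
  rw [gameVal_false_eq_min' v hR]
  exact Finset.mem_image.1 (Finset.min'_mem _ _)

theorem gameVal_erase_insert_le {R : Finset α} {e : α} (he : e ∈ R) (T : Finset α) :
    gameVal v false (R.erase e) (insert e T) ≤ gameVal v true R T := by
  rw [gameVal_true_eq_max' v ⟨e, he⟩]
  exact Finset.le_max' _ _ (Finset.mem_image_of_mem
    (fun e : α => gameVal v false (R.erase e) (insert e T)) he)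

theorem gameVal_false_le_erase {R : Finset α} {e : α} (he : e ∈ R) (T : Finset α) :
    gameVal v false R T ≤ gameVal v true (R.erase e) T := by
  rw [gameVal_false_eq_min' v ⟨e, he⟩]
  exact Finset.min'_le _ _ (Finset.mem_image_of_mem (fun e : α => gameVal v true (R.erase e) T) he)

variable {v} {M : Finset α}

/-- For a monotone valuation, moving first is at least as good as moving second, and additional
remaining items never hurt. -/
theorem gameVal_false_le_true_and_erase_le (hv : ∀ S T : Finset α, S ⊆ T → T ⊆ M → v S ≤ v T)
    (R : Finset α) : ∀ T : Finset α, R ⊆ M → T ⊆ M →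
      gameVal v false R T ≤ gameVal v true R T ∧
        ∀ e ∈ R, ∀ b, gameVal v b (R.erase e) T ≤ gameVal v b R T := by
  induction R using Finset.strongInduction with
  | H R ih =>
    intro T hR hT
    have hsub (e : α) : R.erase e ⊆ M := (Finset.erase_subset e R).trans hR
    have htrue : ∀ e ∈ R, gameVal v true (R.erase e) T ≤ gameVal v true R T := by
      intro e he
      rcases (R.erase e).eq_empty_or_nonempty with h | h
      · have h1 := gameVal_erase_insert_le v he T
        rw [h, gameVal_empty] at h1
        rw [h, gameVal_empty]
        exact (hv _ _ (Finset.subset_insert e T)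
          (Finset.insert_subset (hR he) hT)).trans h1
      · obtain ⟨g, hg, hval⟩ := exists_gameVal_true_eq v h T
        obtain ⟨hge, hgR⟩ := Finset.mem_erase.1 hg
        rw [← hval, Finset.erase_right_comm]
        exact ((ih _ (Finset.erase_ssubset hgR) _ (hsub g)
          (Finset.insert_subset (hR hgR) hT)).2 e
            (Finset.mem_erase.2 ⟨hge.symm, he⟩) false).trans (gameVal_erase_insert_le v hgR T)
    refine ⟨?_, fun e he b => ?_⟩
    · rcases R.eq_empty_or_nonempty with rfl | ⟨e, he⟩
      · simp [gameVal_empty]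
      · exact (gameVal_false_le_erase v he T).trans (htrue e he)
    · cases b with
      | true => exact htrue e he
      | false =>
        obtain ⟨g, hg, hval⟩ := exists_gameVal_false_eq v ⟨e, he⟩ T
        rw [← hval]
        rcases eq_or_ne g e with rfl | hge
        · exact (ih _ (Finset.erase_ssubset hg) T (hsub g) hT).1
        · refine (gameVal_false_le_erase v (Finset.mem_erase.2 ⟨hge, hg⟩) T).trans ?_
          rw [Finset.erase_right_comm]
          exact (ih _ (Finset.erase_ssubset hg) T (hsub g) hT).2 e
            (Finset.mem_erase.2 ⟨hge.symm, he⟩) true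

theorem gameVal_false_le (hv : ∀ S T : Finset α, S ⊆ T → T ⊆ M → v S ≤ v T)
    {R T : Finset α} (hR : R ⊆ M) (hT : T ⊆ M) (b : Bool) :
    gameVal v false R T ≤ gameVal v b R T := by
  cases b with
  | false => exact le_rfl
  | true => exact (gameVal_false_le_true_and_erase_le hv R T hR hT).1

end GameVal

/-- Every partial allocation `T` can be completed by orienting the remaining items `R` so that the
agent `t` gets the value of moving first and all others get the value of moving second. -/
theorem exists_orientation_gameVal_le {α ι : Type*} [DecidableEq α] [DecidableEq ι]
    (M : Finset α) (E : α → Finset ι) (hE : ∀ e ∈ M, (E e).card ≤ 2)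
    (v : ι → Finset α → ℝ)
    (hmono : ∀ i, ∀ S T : Finset α, S ⊆ T → T ⊆ M → v i S ≤ v i T) (R : Finset α) :
    ∀ (T : ι → Finset α) (t : ι), R ⊆ M → (∀ i, T i ⊆ M) →
      ∃ f : α → ι, (∀ e ∈ R, (E e).Nonempty → f e ∈ E e) ∧
        ∀ i, gameVal (v i) (decide (i = t)) (R.filter fun e => i ∈ E e) (T i) ≤
          v i (T i ∪ R.filter fun e => f e = i) := by
  induction R using Finset.strongInduction with
  | H R ih =>
    intro T
    have hfilt (p : α → Prop) [DecidablePred p] (hR : R ⊆ M) : R.filter p ⊆ M :=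
      (Finset.filter_subset p R).trans hR
    have key : ∀ t : ι, R ⊆ M → (∀ i, T i ⊆ M) → (R.filter fun e => t ∈ E e).Nonempty →
        ∃ f : α → ι, (∀ e ∈ R, (E e).Nonempty → f e ∈ E e) ∧
          ∀ i, gameVal (v i) (decide (i = t)) (R.filter fun e => i ∈ E e) (T i) ≤
            v i (T i ∪ R.filter fun e => f e = i) := by
      intro t hR hT hne
      obtain ⟨e, he, hval⟩ := exists_gameVal_true_eq (v t) hne (T t)
      obtain ⟨heR, hte⟩ := Finset.mem_filter.1 he
      have hsub : R.erase e ⊆ M := (Finset.erase_subset e R).trans hR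
      obtain ⟨j, hj⟩ : ∃ j, ∀ i ∈ E e, i = t ∨ i = j := by
        have hcard : ((E e).erase t).card ≤ 1 := by
          rw [Finset.card_erase_of_mem hte]
          have := hE e (hR heR)
          omega
        rcases ((E e).erase t).eq_empty_or_nonempty with h | ⟨j, hj⟩
        · refine ⟨t, fun i hi => ?_⟩
          by_contra hcon
          have : i ∈ (E e).erase t := Finset.mem_erase.2 ⟨fun h => hcon (Or.inl h), hi⟩
          simp [h] at this
        · refine ⟨j, fun i hi => or_iff_not_imp_left.2 fun hit => ?_⟩
          exact Finset.card_le_one.1 hcard i (Finset.mem_erase.2 ⟨hit, hi⟩) j hj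
      have hT' : ∀ i, Function.update T t (insert e (T t)) i ⊆ M := by
        intro i
        rcases eq_or_ne i t with rfl | hit
        · simpa using Finset.insert_subset (hR heR) (hT i)
        · simpa [hit] using hT i
      obtain ⟨f, hf, hle⟩ := ih _ (Finset.erase_ssubset heR)
        (Function.update T t (insert e (T t))) j hsub hT'
      refine ⟨Function.update f e t, fun a ha hane => ?_, fun i => ?_⟩
      · rcases eq_or_ne a e with rfl | hae
        · simpa using hte
        · simpa [hae] using hf a (Finset.mem_erase.2 ⟨hae, ha⟩) hane
      · refine le_trans ?_ ((hle i).trans (hmono i _ _ ?_ ?_))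
        · rw [Finset.filter_erase]
          rcases eq_or_ne i t with rfl | hit
          · rw [decide_eq_true rfl, ← hval, Function.update_self]
            exact gameVal_false_le (hmono i) ((Finset.erase_subset _ _).trans (hfilt _ hR))
              (Finset.insert_subset (hR heR) (hT i)) _
          · rw [decide_eq_false hit, Function.update_of_ne hit]
            by_cases hie : i ∈ E e
            · rw [decide_eq_true ((hj i hie).resolve_left hit)]
              exact gameVal_false_le_erase (v i) (Finset.mem_filter.2 ⟨heR, hie⟩) (T i)
            · rw [Finset.erase_eq_of_notMem (by simp [hie])]
              exact gameVal_false_le (hmono i) (hfilt _ hR) (hT i) _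
        · intro a ha
          by_cases hae : a = e <;> by_cases hit : i = t <;>
            simp_all [Function.update_apply]
        · exact Finset.union_subset (hT i) (hfilt _ hR)
    intro t hR hT
    by_cases hex : ∃ s, (R.filter fun e => s ∈ E e).Nonempty
    · by_cases ht : (R.filter fun e => t ∈ E e).Nonempty
      · exact key t hR hT ht
      · obtain ⟨s, hs⟩ := hex
        obtain ⟨f, hf, hle⟩ := key s hR hT hs
        refine ⟨f, hf, fun i => le_trans ?_ (hle i)⟩
        rcases eq_or_ne i t with rfl | hit
        · rw [Finset.not_nonempty_iff_eq_empty.1 ht, gameVal_empty, gameVal_empty]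
        · rw [decide_eq_false hit]
          exact gameVal_false_le (hmono i) (hfilt _ hR) (hT i) _
    · push Not at hex
      refine ⟨fun _ => t, fun e he ⟨s, hs⟩ => ?_, fun i => ?_⟩
      · have : e ∈ R.filter fun e => s ∈ E e := Finset.mem_filter.2 ⟨he, hs⟩
        simp [hex s] at this
      · rw [hex i, gameVal_empty]
        exact hmono i _ _ Finset.subset_union_left (Finset.union_subset (hT i) (hfilt _ hR))

theorem stmt12 {α : Type*} [DecidableEq α] (n : ℕ) (hn : 0 < n)
    (M : Finset α) (E : α → Finset (Fin n)) (hE : ∀ e ∈ M, (E e).card ≤ 2)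
    (v : Fin n → Finset α → ℝ)
    (hnorm : ∀ i, v i ∅ = 0)
    (hmono : ∀ i, ∀ S T : Finset α, S ⊆ T → T ⊆ M → v i S ≤ v i T)
    (hloc : ∀ i, ∀ S ⊆ M, v i S = v i (S.filter fun e => i ∈ E e)) :
    ∃ f : α → Fin n,
      (∀ e ∈ M, (E e).Nonempty → f e ∈ E e) ∧
      ∀ i, v i (M.filter fun e => f e = i) ≥
        omegaQ (M.filter fun e => i ∈ E e) (v i) := by
  obtain ⟨f, hf, hle⟩ := exists_orientation_gameVal_le M E hE v hmono M (fun _ => ∅)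
    (⟨0, hn⟩ : Fin n) subset_rfl fun _ => Finset.empty_subset M
  refine ⟨f, hf, fun i => ?_⟩
  have h := hle i
  rw [Finset.empty_union] at h
  exact (gameVal_false_le (hmono i) (Finset.filter_subset _ M) (Finset.empty_subset M) _).trans h
end
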